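/- Let A and B be n×n matrices with nonnegative real entries, with tropical spectral radii μ = λ(A) and ν = λ(B), and let H be the associated function. Then for all α, β > 0: Tr(α⁻¹A ⊕ β⁻¹B) ≤ 1 if and only if α ≥ μ and β ≥ max(ν, H(α)). -/

import Mathlib

open scoped BigOperators

noncomputable section

/-- Tropical (max-times) matrix product. -/
def tmul {n : ℕ} (A B : Matrix (Fin n) (Fin n) ℝ) : Matrix (Fin n) (Fin n) ℝ :=
  Matrix.of fun i j => ⨆ k, A i k * B k j

/-- Tropical matrix power: `A^0 = I`, `A^(k+1) = A ⊗ A^k`. -/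
def tpow {n : ℕ} (A : Matrix (Fin n) (Fin n) ℝ) : ℕ → Matrix (Fin n) (Fin n) ℝ
  | 0 => Matrix.of fun i j => if i = j then (1 : ℝ) else 0
  | k + 1 => tmul A (tpow A k)

/-- Tropical trace: `tr A = max_i A i i`. -/
def ttr {n : ℕ} (A : Matrix (Fin n) (Fin n) ℝ) : ℝ := ⨆ i, A i i

/-- `Tr(A) = max_{1 ≤ k ≤ n} tr (A^k)`. -/
def tTr {n : ℕ} (A : Matrix (Fin n) (Fin n) ℝ) : ℝ :=
  ⨆ k : Fin n, ttr (tpow A (k.1 + 1))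

/-- Tropical spectral radius: `λ(A) = max_{1 ≤ k ≤ n} (tr (A^k))^(1/k)`. -/
def specRad {n : ℕ} (A : Matrix (Fin n) (Fin n) ℝ) : ℝ :=
  ⨆ k : Fin n, (ttr (tpow A (k.1 + 1))) ^ ((1 : ℝ) / ((k.1 : ℝ) + 1))

/-- Kleene star: `A* = I ⊕ A ⊕ ⋯ ⊕ A^(n-1)` (entrywise max of tropical powers). -/
def kstar {n : ℕ} (A : Matrix (Fin n) (Fin n) ℝ) : Matrix (Fin n) (Fin n) ℝ :=
  Matrix.of fun i j => ⨆ k : Fin n, tpow A k.1 i j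

/-- `B ⊗ A^(i₁) ⊗ B ⊗ A^(i₂) ⊗ ⋯ ⊗ B ⊗ A^(i_k)` for a list `(i₁, …, i_k)`. -/
def wordProd {n : ℕ} (A B : Matrix (Fin n) (Fin n) ℝ) : List ℕ → Matrix (Fin n) (Fin n) ℝ
  | [] => tpow A 0
  | i :: l => tmul (tmul B (tpow A i)) (wordProd A B l)

/-- The function `G(s)` associated with matrices `A`, `B`. -/
def Gfun {n : ℕ} (A B : Matrix (Fin n) (Fin n) ℝ) (s : ℝ) : ℝ :=
  sSup { v : ℝ | ∃ (k m : ℕ) (t : Fin k → ℕ),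
    1 ≤ k ∧ k ≤ n - 1 ∧ 1 ≤ m ∧ m ≤ n - k ∧ (∑ j, t j) = m ∧
    v = s ^ (-(k : ℝ) / (m : ℝ)) *
      (ttr (wordProd A B (List.ofFn t))) ^ ((1 : ℝ) / (m : ℝ)) }

/-- The function `H(t)` associated with matrices `A`, `B`. -/
def Hfun {n : ℕ} (A B : Matrix (Fin n) (Fin n) ℝ) (t : ℝ) : ℝ :=
  sSup { v : ℝ | ∃ (k m : ℕ) (w : Fin k → ℕ),
    1 ≤ k ∧ k ≤ n - 1 ∧ 1 ≤ m ∧ m ≤ n - k ∧ (∑ j, w j) = m ∧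
    v = t ^ (-(m : ℝ) / (k : ℝ)) *
      (ttr (wordProd A B (List.ofFn w))) ^ ((1 : ℝ) / (k : ℝ)) }

/-- The objective `f(x) = max_{i,j} A i j * x j / x i`. -/
def obj {n : ℕ} (A : Matrix (Fin n) (Fin n) ℝ) (x : Fin n → ℝ) : ℝ :=
  ⨆ i, ⨆ j, A i j * x j / x i

/-- `x` is a positive Pareto-optimal point for minimizing `(obj A, obj B)`. -/
def ParetoOptimal {n : ℕ} (A B : Matrix (Fin n) (Fin n) ℝ) (x : Fin n → ℝ) : Prop :=
  (∀ i, 0 < x i) ∧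
    ¬ ∃ y : Fin n → ℝ, (∀ i, 0 < y i) ∧ obj A y ≤ obj A x ∧ obj B y ≤ obj B x ∧
      (obj A y, obj B y) ≠ (obj A x, obj B x)

/-- The Pareto frontier of the bi-objective problem. -/
def ParetoFrontier {n : ℕ} (A B : Matrix (Fin n) (Fin n) ℝ) : Set (ℝ × ℝ) :=
  { p | ∃ x : Fin n → ℝ, ParetoOptimal A B x ∧ p = (obj A x, obj B x) }

theorem tmul_exists {n : ℕ} (A B : Matrix (Fin n) (Fin n) ℝ) (i j : Fin n) :
    ∃ k, tmul A B i j = A i k * B k j := by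
  haveI : Nonempty (Fin n) := ⟨i⟩
  obtain ⟨k, hk⟩ := exists_eq_ciSup_of_finite (f := fun k => A i k * B k j)
  exact ⟨k, hk.symm⟩

theorem le_tmul {n : ℕ} (A B : Matrix (Fin n) (Fin n) ℝ) (i j k : Fin n) :
    A i k * B k j ≤ tmul A B i j :=
  le_ciSup (f := fun k => A i k * B k j) (Set.finite_range _).bddAbove k

theorem tmul_nonneg {n : ℕ} {A B : Matrix (Fin n) (Fin n) ℝ}
    (hA : ∀ i j, 0 ≤ A i j) (hB : ∀ i j, 0 ≤ B i j) (i j : Fin n) : 0 ≤ tmul A B i j := by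
  obtain ⟨k, hk⟩ := tmul_exists A B i j
  rw [hk]; exact mul_nonneg (hA _ _) (hB _ _)

theorem tpow_nonneg {n : ℕ} {A : Matrix (Fin n) (Fin n) ℝ}
    (hA : ∀ i j, 0 ≤ A i j) (k : ℕ) : ∀ i j, 0 ≤ tpow A k i j := by
  induction k with
  | zero => intro i j; simp only [tpow, Matrix.of_apply]; split_ifs <;> norm_num
  | succ k ih => exact tmul_nonneg hA ih

theorem tmul_assoc' {n : ℕ} {A B C : Matrix (Fin n) (Fin n) ℝ}
    (hA : ∀ i j, 0 ≤ A i j) (hC : ∀ i j, 0 ≤ C i j) :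
    tmul (tmul A B) C = tmul A (tmul B C) := by
  ext i j
  apply le_antisymm
  · obtain ⟨k, hk⟩ := tmul_exists (tmul A B) C i j
    obtain ⟨l, hl⟩ := tmul_exists A B i k
    rw [hk, hl, mul_assoc]
    exact (mul_le_mul_of_nonneg_left (le_tmul B C l j k) (hA _ _)).trans (le_tmul A _ i j l)
  · obtain ⟨k, hk⟩ := tmul_exists A (tmul B C) i j
    obtain ⟨l, hl⟩ := tmul_exists B C k j
    rw [hk, hl, ← mul_assoc]
    exact (mul_le_mul_of_nonneg_right (le_tmul A B i l k) (hC _ _)).trans (le_tmul _ C i j l)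

theorem tone_tmul {n : ℕ} {A B : Matrix (Fin n) (Fin n) ℝ}
    (hB : ∀ i j, 0 ≤ B i j) : tmul (tpow A 0) B = B := by
  ext i j
  apply le_antisymm
  · obtain ⟨k, hk⟩ := tmul_exists (tpow A 0) B i j
    rw [hk]
    simp only [tpow, Matrix.of_apply]
    split_ifs with h
    · subst h; simp
    · simpa using hB i j
  · have := le_tmul (tpow A 0) B i j i
    simpa [tpow] using this

theorem tmul_tone {n : ℕ} {A B : Matrix (Fin n) (Fin n) ℝ}
    (hB : ∀ i j, 0 ≤ B i j) : tmul B (tpow A 0) = B := by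
  ext i j
  apply le_antisymm
  · obtain ⟨k, hk⟩ := tmul_exists B (tpow A 0) i j
    rw [hk]
    simp only [tpow, Matrix.of_apply]
    split_ifs with h
    · subst h; simp
    · simpa using hB i j
  · have := le_tmul B (tpow A 0) i j j
    simpa [tpow] using this

theorem tpow_add {n : ℕ} {A : Matrix (Fin n) (Fin n) ℝ}
    (hA : ∀ i j, 0 ≤ A i j) (p q : ℕ) : tpow A (p + q) = tmul (tpow A p) (tpow A q) := by
  induction p with
  | zero => rw [tone_tmul (tpow_nonneg hA q), Nat.zero_add]
  | succ p ih =>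
    rw [show p + 1 + q = (p + q) + 1 by omega]
    simp only [tpow]
    rw [ih, tmul_assoc' hA (tpow_nonneg hA q)]

theorem le_ttr {n : ℕ} (A : Matrix (Fin n) (Fin n) ℝ) (i : Fin n) : A i i ≤ ttr A :=
  le_ciSup (f := fun i => A i i) (Set.finite_range _).bddAbove i

theorem ttr_le {n : ℕ} {A : Matrix (Fin n) (Fin n) ℝ} {c : ℝ} (hc : 0 ≤ c)
    (h : ∀ i, A i i ≤ c) : ttr A ≤ c := Real.iSup_le h hc

theorem ttr_nonneg {n : ℕ} {A : Matrix (Fin n) (Fin n) ℝ}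
    (hA : ∀ i j, 0 ≤ A i j) : 0 ≤ ttr A := Real.iSup_nonneg fun i => hA i i

theorem ttr_comm_le {n : ℕ} {A B : Matrix (Fin n) (Fin n) ℝ}
    (hA : ∀ i j, 0 ≤ A i j) (hB : ∀ i j, 0 ≤ B i j) :
    ttr (tmul A B) ≤ ttr (tmul B A) := by
  apply ttr_le (ttr_nonneg (tmul_nonneg hB hA))
  intro i
  obtain ⟨k, hk⟩ := tmul_exists A B i i
  rw [hk, mul_comm]
  exact (le_tmul B A k k i).trans (le_ttr _ k)

/-- Product along a Boolean word (`true` is `B`, `false` is `A`). -/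
def bword {n : ℕ} (A B : Matrix (Fin n) (Fin n) ℝ) : List Bool → Matrix (Fin n) (Fin n) ℝ
  | [] => tpow A 0
  | b :: l => tmul (if b then B else A) (bword A B l)

section
variable {n : ℕ} {A B : Matrix (Fin n) (Fin n) ℝ}

theorem ite_nn (hA : ∀ i j, 0 ≤ A i j) (hB : ∀ i j, 0 ≤ B i j) (b : Bool) :
    ∀ i j, 0 ≤ (if b then B else A) i j := by
  cases b
  · simpa using hA
  · simpa using hB

theorem bword_nonneg (hA : ∀ i j, 0 ≤ A i j) (hB : ∀ i j, 0 ≤ B i j) (w : List Bool) :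
    ∀ i j, 0 ≤ bword A B w i j := by
  induction w with
  | nil => exact tpow_nonneg hA 0
  | cons b l ih => exact tmul_nonneg (ite_nn hA hB b) ih

theorem wordProd_nonneg (hA : ∀ i j, 0 ≤ A i j) (hB : ∀ i j, 0 ≤ B i j) (w : List ℕ) :
    ∀ i j, 0 ≤ wordProd A B w i j := by
  induction w with
  | nil => exact tpow_nonneg hA 0
  | cons b l ih => exact tmul_nonneg (tmul_nonneg hB (tpow_nonneg hA _)) ih

theorem bword_append (hA : ∀ i j, 0 ≤ A i j) (hB : ∀ i j, 0 ≤ B i j) (u v : List Bool) :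
    bword A B (u ++ v) = tmul (bword A B u) (bword A B v) := by
  induction u with
  | nil => exact (tone_tmul (bword_nonneg hA hB v)).symm
  | cons b l ih =>
    simp only [List.cons_append, bword]
    rw [ih, tmul_assoc' (ite_nn hA hB b) (bword_nonneg hA hB v)]

theorem bword_decomp (hA : ∀ i j, 0 ≤ A i j) (hB : ∀ i j, 0 ≤ B i j) (w : List Bool) :
    ∃ (p : ℕ) (l : List ℕ), bword A B w = tmul (tpow A p) (wordProd A B l) ∧
      p + l.sum = w.count false ∧ l.length = w.count true := by
  induction w with
  | nil => exact ⟨0, [], by simp [bword, wordProd, tone_tmul (tpow_nonneg hA 0)]⟩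
  | cons b w ih =>
    obtain ⟨p, l, h, h1, h2⟩ := ih
    cases b
    · refine ⟨p + 1, l, ?_, ?_, ?_⟩
      · simp only [bword, tpow, h]
        rw [tmul_assoc' hA (wordProd_nonneg hA hB l)]; simp
      · simp; omega
      · simpa using h2
    · refine ⟨0, p :: l, ?_, ?_, ?_⟩
      · rw [tone_tmul (wordProd_nonneg hA hB _)]
        simp only [bword, wordProd, h]
        rw [tmul_assoc' hB (wordProd_nonneg hA hB l)]; simp
      · simpa using h1
      · simpa using h2

theorem bword_rot (hA : ∀ i j, 0 ≤ A i j) (hB : ∀ i j, 0 ≤ B i j) (w : List Bool)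
    (hw : true ∈ w) :
    ∃ l : List ℕ, ttr (bword A B w) ≤ ttr (wordProd A B l) ∧
      l.sum = w.count false ∧ l.length = w.count true := by
  obtain ⟨u, v, rfl⟩ := List.append_of_mem hw
  obtain ⟨p, l, h, h1, h2⟩ := bword_decomp hA hB (v ++ u)
  refine ⟨p :: l, ?_, ?_, ?_⟩
  · rw [bword_append hA hB]
    refine (ttr_comm_le (bword_nonneg hA hB _) (bword_nonneg hA hB _)).trans ?_
    rw [← bword_append hA hB, List.cons_append]
    simp only [bword, wordProd, h]
    rw [tmul_assoc' hB (wordProd_nonneg hA hB l)]; simp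
  · simp at h1 ⊢; omega
  · simp at h2 ⊢; omega

theorem bword_replicate (b : Bool) (k : ℕ) :
    bword A B (List.replicate k b) = tpow (if b then B else A) k := by
  induction k with
  | zero => rfl
  | succ k ih => simp only [List.replicate_succ, bword, tpow, ih]

theorem exists_word (hA : ∀ i j, 0 ≤ A i j) (hB : ∀ i j, 0 ≤ B i j) {α β : ℝ}
    (hα : 0 < α) (hβ : 0 < β) (k : ℕ) (i j : Fin n) :
    ∃ w : List Bool, w.length = k ∧
      tpow (Matrix.of fun i j => max (A i j / α) (B i j / β)) k i j *
        (α ^ w.count false * β ^ w.count true) ≤ bword A B w i j := by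
  induction k generalizing i with
  | zero => exact ⟨[], rfl, by simp [tpow, bword]⟩
  | succ k ih =>
    obtain ⟨l, hl⟩ := tmul_exists (Matrix.of fun i j => max (A i j / α) (B i j / β))
      (tpow (Matrix.of fun i j => max (A i j / α) (B i j / β)) k) i j
    obtain ⟨w, hw, h⟩ := ih l
    simp only [tpow, hl]
    simp only [Matrix.of_apply]
    rcases max_choice (A i l / α) (B i l / β) with hm | hm
    · refine ⟨false :: w, by simp [hw], ?_⟩
      rw [hm]
      refine le_trans (le_of_eq ?_) ((mul_le_mul_of_nonneg_left h (hA i l)).trans ?_)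
      · simp [pow_succ]; field_simp
      · simpa [bword] using le_tmul A (bword A B w) i j l
    · refine ⟨true :: w, by simp [hw], ?_⟩
      rw [hm]
      refine le_trans (le_of_eq ?_) ((mul_le_mul_of_nonneg_left h (hB i l)).trans ?_)
      · simp [pow_succ]; field_simp
      · simpa [bword] using le_tmul B (bword A B w) i j l

theorem tmul_bound {X Y Z W : Matrix (Fin n) (Fin n) ℝ} {a b : ℝ}
    (hY : ∀ i j, 0 ≤ Y i j) (hZ : ∀ i j, 0 ≤ Z i j) (ha : 0 ≤ a) (hb : 0 ≤ b)
    (h1 : ∀ i j, X i j ≤ a * Z i j) (h2 : ∀ i j, Y i j ≤ b * W i j) (i j : Fin n) :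
    tmul X Y i j ≤ (a * b) * tmul Z W i j := by
  obtain ⟨k, hk⟩ := tmul_exists X Y i j
  rw [hk]
  calc X i k * Y k j ≤ (a * Z i k) * (b * W k j) :=
        mul_le_mul (h1 _ _) (h2 _ _) (hY _ _) (mul_nonneg ha (hZ _ _))
    _ = (a * b) * (Z i k * W k j) := by ring
    _ ≤ _ := mul_le_mul_of_nonneg_left (le_tmul Z W i j k) (mul_nonneg ha hb)

theorem tpow_bound {C : Matrix (Fin n) (Fin n) ℝ} {a : ℝ} (hA : ∀ i j, 0 ≤ A i j)
    (hC : ∀ i j, 0 ≤ C i j) (ha : 0 ≤ a) (h : ∀ i j, A i j ≤ a * C i j) (k : ℕ) :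
    ∀ i j, tpow A k i j ≤ a ^ k * tpow C k i j := by
  induction k with
  | zero => intro i j; simp [tpow]
  | succ k ih =>
    rw [pow_succ']
    exact tmul_bound (tpow_nonneg hA k) hC ha (pow_nonneg ha k) h ih

theorem wordProd_bound {C : Matrix (Fin n) (Fin n) ℝ} {a b : ℝ} (hA : ∀ i j, 0 ≤ A i j)
    (hB : ∀ i j, 0 ≤ B i j)
    (hC : ∀ i j, 0 ≤ C i j) (ha : 0 ≤ a) (hb : 0 ≤ b) (h1 : ∀ i j, A i j ≤ a * C i j)
    (h2 : ∀ i j, B i j ≤ b * C i j) (l : List ℕ) :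
    ∀ i j, wordProd A B l i j ≤ (a ^ l.sum * b ^ l.length) * tpow C (l.sum + l.length) i j := by
  induction l with
  | nil => intro i j; simp [wordProd, tpow]
  | cons p l ih =>
    have e1 : tpow C ((p :: l).sum + (p :: l).length) =
        tmul (tmul C (tpow C p)) (tpow C (l.sum + l.length)) := by
      rw [show (p :: l).sum + (p :: l).length = (p + 1) + (l.sum + l.length) by simp; omega,
        tpow_add hC]
      rfl
    have e2 : a ^ (p :: l).sum * b ^ (p :: l).length =
        (b * a ^ p) * (a ^ l.sum * b ^ l.length) := by
      simp [pow_add]; ring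
    rw [e1, e2]
    exact tmul_bound (wordProd_nonneg hA hB l) (tmul_nonneg hC (tpow_nonneg hC p))
      (by positivity) (by positivity)
      (tmul_bound (tpow_nonneg hA p) hC hb (by positivity) h2 (tpow_bound hA hC ha h1 p)) ih

theorem specRad_le_iff (hA : ∀ i j, 0 ≤ A i j) {α : ℝ} (hα : 0 < α) :
    specRad A ≤ α ↔ ∀ k, 1 ≤ k → k ≤ n → ttr (tpow A k) ≤ α ^ k := by
  have key : ∀ k : ℕ, (ttr (tpow A (k + 1))) ^ ((1 : ℝ) / ((k : ℝ) + 1)) ≤ α ↔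
      ttr (tpow A (k + 1)) ≤ α ^ (k + 1) := by
    intro k
    rw [one_div, Real.rpow_inv_le_iff_of_pos (ttr_nonneg (tpow_nonneg hA _)) hα.le (by positivity)]
    rw [show (k : ℝ) + 1 = ((k + 1 : ℕ) : ℝ) by push_cast; ring, Real.rpow_natCast]
  constructor
  · intro h k h1 h2
    obtain ⟨k, rfl⟩ : ∃ k', k = k' + 1 := ⟨k - 1, by omega⟩
    rw [← key]
    exact (le_ciSup (f := fun k : Fin n =>
      (ttr (tpow A (k.1 + 1))) ^ ((1 : ℝ) / ((k.1 : ℝ) + 1)))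
      (Set.finite_range _).bddAbove ⟨k, by omega⟩).trans h
  · intro h
    exact Real.iSup_le (fun k => (key k.1).2 (h _ (by omega) (by omega))) hα.le

theorem Hfun_le_iff (hA : ∀ i j, 0 ≤ A i j) (hB : ∀ i j, 0 ≤ B i j) {α β : ℝ}
    (hα : 0 < α) (hβ : 0 < β) :
    Hfun A B α ≤ β ↔ ∀ l : List ℕ, 1 ≤ l.length → 1 ≤ l.sum → l.sum + l.length ≤ n →
      ttr (wordProd A B l) ≤ α ^ l.sum * β ^ l.length := by
  have key : ∀ (k m : ℕ) (x : ℝ), 1 ≤ k → 0 ≤ x →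
      (α ^ (-(m : ℝ) / (k : ℝ)) * x ^ ((1 : ℝ) / (k : ℝ)) ≤ β ↔ x ≤ α ^ m * β ^ k) := by
    intro k m x hk hx
    have hk' : (0 : ℝ) < k := by exact_mod_cast hk
    have : α ^ (-(m : ℝ) / (k : ℝ)) * x ^ ((1 : ℝ) / (k : ℝ)) = (x / α ^ m) ^ ((k : ℝ)⁻¹) := by
      rw [div_eq_mul_inv, Real.rpow_mul hα.le, Real.rpow_neg hα.le, Real.rpow_natCast, one_div,
        ← Real.mul_rpow (by positivity) hx]
      congr 1
      field_simp
    rw [this, Real.rpow_inv_le_iff_of_pos (by positivity) hβ.le hk', Real.rpow_natCast,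
      div_le_iff₀ (by positivity), mul_comm]
  constructor
  · intro h l h1 h2 h3
    rw [← key _ _ _ h1 (ttr_nonneg (wordProd_nonneg hA hB l))]
    refine le_trans (le_csSup ?_ ?_) h
    · apply Set.Finite.bddAbove
      refine Set.Finite.subset (s := ⋃ k ∈ Set.Iic n, ⋃ m ∈ Set.Iic n,
        (fun w : Fin k → ℕ => α ^ (-(m : ℝ) / (k : ℝ)) *
          (ttr (wordProd A B (List.ofFn w))) ^ ((1 : ℝ) / (k : ℝ))) ''
          (Set.Iic fun _ => n)) ?_ ?_
      · refine (Set.finite_Iic n).biUnion fun k _ => (Set.finite_Iic n).biUnion fun m _ => ?_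
        exact (Set.finite_Iic _).image _
      · rintro v ⟨k, m, w, a1, a2, a3, a4, a5, rfl⟩
        simp only [Set.mem_iUnion]
        refine ⟨k, by simp; omega, m, by simp; omega, w, ?_, rfl⟩
        intro j
        have := Finset.single_le_sum (f := w) (fun _ _ => Nat.zero_le _) (Finset.mem_univ j)
        show w j ≤ n
        omega
    · refine ⟨l.length, l.sum, l.get, h1, by omega, h2, by omega, ?_, ?_⟩
      · rw [← List.sum_ofFn, List.ofFn_get]
      · rw [List.ofFn_get]
  · intro h
    refine Real.sSup_le ?_ hβ.le
    rintro v ⟨k, m, w, a1, a2, a3, a4, a5, rfl⟩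
    rw [key _ _ _ a1 (ttr_nonneg (wordProd_nonneg hA hB _))]
    have hs : (List.ofFn w).sum = m := by rw [List.sum_ofFn, a5]
    have hl : (List.ofFn w).length = k := List.length_ofFn
    have := h (List.ofFn w) (by omega) (by omega) (by omega)
    rwa [hs, hl] at this

theorem tTr_le_iff : tTr A ≤ 1 ↔ ∀ k, 1 ≤ k → k ≤ n → ∀ i, tpow A k i i ≤ 1 := by
  constructor
  · intro h k h1 h2 i
    obtain ⟨k, rfl⟩ : ∃ k', k = k' + 1 := ⟨k - 1, by omega⟩
    exact (le_ttr _ i).trans ((le_ciSup (f := fun k : Fin n => ttr (tpow A (k.1 + 1)))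
      (Set.finite_range _).bddAbove ⟨k, by omega⟩).trans h)
  · intro h
    exact Real.iSup_le (fun k => ttr_le zero_le_one (h _ (by omega) (by omega))) zero_le_one

end

/-- `Tr(α⁻¹ A ⊕ β⁻¹ B) ≤ 1 ↔ α ≥ μ ∧ β ≥ max(ν, H(α))`. -/
theorem stmt15 {n : ℕ} (A B : Matrix (Fin n) (Fin n) ℝ)
    (hA : ∀ i j, 0 ≤ A i j) (hB : ∀ i j, 0 ≤ B i j)
    (α β : ℝ) (hα : 0 < α) (hβ : 0 < β) :
    tTr (Matrix.of fun i j => max (A i j / α) (B i j / β)) ≤ 1 ↔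
      specRad A ≤ α ∧ max (specRad B) (Hfun A B α) ≤ β := by
  rw [max_le_iff, specRad_le_iff hA hα, specRad_le_iff hB hβ, Hfun_le_iff hA hB hα hβ, tTr_le_iff]
  set C : Matrix (Fin n) (Fin n) ℝ := Matrix.of fun i j => max (A i j / α) (B i j / β) with hCdef
  have hC : ∀ i j, 0 ≤ C i j := fun i j => le_max_of_le_left (div_nonneg (hA i j) hα.le)
  have hAC : ∀ i j, A i j ≤ α * C i j := fun i j => by
    rw [mul_comm, ← div_le_iff₀ hα]; exact le_max_left _ _
  have hBC : ∀ i j, B i j ≤ β * C i j := fun i j => by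
    rw [mul_comm, ← div_le_iff₀ hβ]; exact le_max_right _ _
  constructor
  · intro h
    refine ⟨fun k h1 h2 => ?_, fun k h1 h2 => ?_, fun l h1 h2 h3 => ?_⟩
    · refine ttr_le (by positivity) fun i => (tpow_bound hA hC hα.le hAC k i i).trans ?_
      exact mul_le_of_le_one_right (by positivity) (h k h1 h2 i)
    · refine ttr_le (by positivity) fun i => (tpow_bound hB hC hβ.le hBC k i i).trans ?_
      exact mul_le_of_le_one_right (by positivity) (h k h1 h2 i)
    · refine ttr_le (by positivity) fun i =>
        (wordProd_bound hA hB hC hα.le hβ.le hAC hBC l i i).trans ?_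
      exact mul_le_of_le_one_right (by positivity) (h _ (by omega) h3 i)
  · rintro ⟨h1, h2, h3⟩ k hk1 hk2 i
    obtain ⟨w, hw, hle⟩ := exists_word hA hB hα hβ k i i
    have hcnt : w.count false + w.count true = w.length := by
      rw [List.count_false_add_count_true]
    have hpos : 0 < α ^ w.count false * β ^ w.count true := by positivity
    have hfin : ttr (bword A B w) ≤ α ^ w.count false * β ^ w.count true := by
      by_cases ht : true ∈ w
      · by_cases hf : false ∈ w
        · obtain ⟨l, b1, b2, b3⟩ := bword_rot hA hB w ht
          have c1 := List.count_pos_iff.2 ht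
          have c2 := List.count_pos_iff.2 hf
          have := h3 l (by omega) (by omega) (by omega)
          rw [b2, b3] at this
          exact b1.trans this
        · have hr : w = List.replicate k true := by
            rw [List.eq_replicate_iff]
            refine ⟨hw, fun b hb => ?_⟩
            cases b
            · exact absurd hb hf
            · rfl
          rw [hr, bword_replicate]
          simpa [List.count_replicate] using h2 k hk1 hk2
      · have hr : w = List.replicate k false := by
          rw [List.eq_replicate_iff]
          refine ⟨hw, fun b hb => ?_⟩
          cases b
          · rfl
          · exact absurd hb ht
        rw [hr, bword_replicate]
        simpa [List.count_replicate] using h1 k hk1 hk2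
    have := hle.trans ((le_ttr _ i).trans hfin)
    exact (mul_le_iff_le_one_left hpos).1 this
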